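/- One has −(2δ/d + η) ≤ h(r) < 0 for all r ≥ δ, and there exist constants C ∈ (0,∞) and η̃ ∈ (0,η) such that ∫_δ^r h(s) ds ≥ −C − η̃ (r − δ) for all r ∈ [δ,∞). -/

import Mathlib

open Real Set Filter

noncomputable section

/-- `δ = exp(−(d+2)/(2d))`. -/
def deltaOf (d : ℕ) : ℝ := Real.exp (-((d : ℝ) + 2) / (2 * d))

/-- The bracketed expression in the explicit formula for `h`. -/
def Bfun (d : ℕ) (α η : ℝ) (r : ℝ) : ℝ :=
  if d = 2 then
    (deltaOf d)⁻¹ * (deltaOf d + η)⁻¹ + α * Real.log (r / deltaOf d)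
  else
    ((deltaOf d)⁻¹ * (2 * deltaOf d / d + η)⁻¹ + α / ((d : ℝ) - 2))
        * (r / deltaOf d) ^ ((d : ℝ) - 2)
      - α / ((d : ℝ) - 2)

/-- The explicit solution `h` of the Riccati equation (A.1)–(A.2). -/
def hfun (d : ℕ) (α η : ℝ) (r : ℝ) : ℝ := -r⁻¹ * (Bfun d α η r)⁻¹

theorem deltaOf_pos (d : ℕ) : 0 < deltaOf d := Real.exp_pos _

theorem continuousOn_Bfun (d : ℕ) (α η : ℝ) : ContinuousOn (Bfun d α η) (Ioi 0) := by
  have hδ := deltaOf_pos d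
  have hdiv : ContinuousOn (fun r : ℝ => r / deltaOf d) (Ioi 0) := by fun_prop
  have hne : ∀ r ∈ Ioi (0 : ℝ), r / deltaOf d ≠ 0 := fun r hr => (div_pos hr hδ).ne'
  unfold Bfun
  split_ifs
  · exact continuousOn_const.add (continuousOn_const.mul (hdiv.log hne))
  · exact (continuousOn_const.mul (hdiv.rpow_const fun r hr => Or.inl (hne r hr))).sub
      continuousOn_const

/-- The denominator `r B(r)` of `-h` grows at least linearly. -/
theorem le_mul_Bfun {d : ℕ} (hd : 1 ≤ d) {α η r : ℝ} (hα : 0 < α) (hη : 0 < η)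
    (hr : deltaOf d ≤ r) :
    (2 * deltaOf d / d + η)⁻¹
        + min α ((deltaOf d)⁻¹ * (2 * deltaOf d / d + η)⁻¹) * (r - deltaOf d)
      ≤ r * Bfun d α η r := by
  have hδ := deltaOf_pos d
  have hr₀ : 0 < r := hδ.trans_le hr
  have hx : 1 ≤ r / deltaOf d := (one_le_div hδ).2 hr
  have hM : 0 < 2 * deltaOf d / d + η := by positivity
  have hB₀ : 0 < (deltaOf d)⁻¹ * (2 * deltaOf d / d + η)⁻¹ := by positivity
  have hMB : (2 * deltaOf d / d + η)⁻¹
      = deltaOf d * ((deltaOf d)⁻¹ * (2 * deltaOf d / d + η)⁻¹) := by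
    field_simp
  have of_le (h : (deltaOf d)⁻¹ * (2 * deltaOf d / d + η)⁻¹ ≤ Bfun d α η r) :
      (2 * deltaOf d / d + η)⁻¹
        + min α ((deltaOf d)⁻¹ * (2 * deltaOf d / d + η)⁻¹) * (r - deltaOf d)
      ≤ r * Bfun d α η r := by
    have h₁ := mul_le_mul_of_nonneg_right
      (min_le_right α ((deltaOf d)⁻¹ * (2 * deltaOf d / d + η)⁻¹)) (sub_nonneg.2 hr)
    have h₂ := mul_le_mul_of_nonneg_left h hr₀.le
    linarith
  obtain rfl | rfl | hd₃ : d = 1 ∨ d = 2 ∨ 3 ≤ d := by omega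
  · have hBr : r * Bfun 1 α η r
        = (2 * deltaOf 1 / (1 : ℕ) + η)⁻¹ + α * (r - deltaOf 1) := by
      have hexp : ((1 : ℕ) : ℝ) - 2 = -1 := by norm_num
      rw [Bfun, if_neg (by norm_num), hexp, rpow_neg_one]
      field_simp
      ring
    rw [hBr]
    gcongr
    exact min_le_left _ _
  · apply of_le
    have hM₂ : 2 * deltaOf 2 / (2 : ℕ) = deltaOf 2 := by norm_num
    rw [Bfun, if_pos rfl, hM₂]
    exact le_add_of_nonneg_right (mul_nonneg hα.le (log_nonneg hx))
  · apply of_le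
    have hp : (0 : ℝ) < (d : ℝ) - 2 := by
      have : (3 : ℝ) ≤ d := by exact_mod_cast hd₃
      linarith
    have hpow : 1 ≤ (r / deltaOf d) ^ ((d : ℝ) - 2) := one_le_rpow hx hp.le
    have hq := div_pos hα hp
    rw [Bfun, if_neg (by omega)]
    nlinarith [le_mul_of_one_le_right (add_pos hB₀ hq).le hpow]

/-- the bounds `−(2δ/d + η) ≤ h < 0` on `[δ,∞)`, and the linear
lower bound `∫_δ^r h ≥ −C − η̃(r−δ)` for some `C > 0` and some `η̃ ∈ (0,η)`. -/
theorem stmt19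
    (d : ℕ) (hd : 1 ≤ d) (α η : ℝ) (hα : 0 < α) (hη : 0 < η) :
    (∀ r : ℝ, deltaOf d ≤ r →
      -(2 * deltaOf d / d + η) ≤ hfun d α η r ∧ hfun d α η r < 0)
    ∧ ∃ C : ℝ, 0 < C ∧ ∃ ηt : ℝ, ηt ∈ Ioo 0 η ∧
        ∀ r : ℝ, deltaOf d ≤ r →
          -C - ηt * (r - deltaOf d) ≤ ∫ s in (deltaOf d)..r, hfun d α η s := by
  have hδ := deltaOf_pos d
  have hM : 0 < 2 * deltaOf d / d + η := by positivity
  have hB₀ : 0 < (deltaOf d)⁻¹ * (2 * deltaOf d / d + η)⁻¹ := by positivity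
  obtain ⟨c, hc, hG⟩ : ∃ c : ℝ, 0 < c ∧ ∀ r, deltaOf d ≤ r →
      (2 * deltaOf d / d + η)⁻¹ + c * (r - deltaOf d) ≤ r * Bfun d α η r :=
    ⟨_, lt_min hα hB₀, fun r hr => le_mul_Bfun hd hα hη hr⟩
  have hη_lt : η < 2 * deltaOf d / d + η := lt_add_of_pos_left η (by positivity)
  set M := 2 * deltaOf d / d + η
  have hlow : ∀ r, deltaOf d ≤ r → 0 < M⁻¹ + c * (r - deltaOf d) := fun r hr =>
    add_pos_of_pos_of_nonneg (inv_pos.2 hM) (mul_nonneg hc.le (sub_nonneg.2 hr))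
  have hh : ∀ r, hfun d α η r = -(r * Bfun d α η r)⁻¹ := fun r => by
    rw [hfun, mul_inv, neg_mul]
  refine ⟨fun r hr => ?_, (M / (η / 2)) / c, by positivity, η / 2, ⟨by positivity, by linarith⟩,
    fun r hr => ?_⟩
  · have hle : M⁻¹ ≤ r * Bfun d α η r :=
      (le_add_of_nonneg_right (mul_nonneg hc.le (sub_nonneg.2 hr))).trans (hG r hr)
    have hpos : 0 < r * Bfun d α η r := (inv_pos.2 hM).trans_le hle
    rw [hh]
    exact ⟨neg_le_neg (inv_le_of_inv_le₀ hM hle), neg_lt_zero.2 (inv_pos.2 hpos)⟩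
  · have hcont : ContinuousOn (hfun d α η) (Icc (deltaOf d) r) := by
      have hBc := (continuousOn_Bfun d α η).mono fun s (hs : s ∈ Icc (deltaOf d) r) =>
        hδ.trans_le hs.1
      refine ((continuousOn_id.mul hBc).inv₀ fun s hs => ?_).neg.congr fun s _ => hh s
      exact ((hlow s hs.1).trans_le (hG s hs.1)).ne'
    have hderiv : ∀ s, deltaOf d ≤ s →
        HasDerivAt (fun s => -(log (M⁻¹ + c * (s - deltaOf d)) / c))
          (-(M⁻¹ + c * (s - deltaOf d))⁻¹) s := fun s hs => by
      have h := (((((hasDerivAt_id s).sub_const (deltaOf d)).const_mul c).const_add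
        M⁻¹).log (hlow s hs).ne').div_const c |>.neg
      refine h.congr_deriv ?_
      have := (hlow s hs).ne'
      simp only [id]
      field_simp
    have hint := intervalIntegral.sub_le_integral_of_hasDeriv_right_of_le hr
      (fun s hs => (hderiv s hs.1).continuousAt.continuousWithinAt)
      (fun s hs => (hderiv s hs.1.le).hasDerivWithinAt)
      hcont.integrableOn_Icc
      (fun s hs => by
        rw [hh]
        exact neg_le_neg (inv_anti₀ (hlow s hs.1.le) (hG s hs.1.le)))
    refine le_trans ?_ hint
    have hη₂ : 0 < η / 2 := by positivity
    have hlog := log_le_sub_one_of_pos (mul_pos (hlow r hr) hη₂)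
    have hlog' := log_le_sub_one_of_pos (div_pos hM hη₂)
    rw [log_mul (hlow r hr).ne' hη₂.ne'] at hlog
    rw [log_div hM.ne' hη₂.ne'] at hlog'
    have hratio : M⁻¹ * (η / 2) ≤ 1 := by
      rw [inv_mul_le_one₀ hM]
      linarith
    have hsum : log (M⁻¹ + c * (r - deltaOf d)) + log M
        ≤ M / (η / 2) + c * (η / 2 * (r - deltaOf d)) := by
      linarith
    have hdiv := div_le_div_of_nonneg_right hsum hc.le
    rw [add_div, add_div, mul_div_cancel_left₀ _ hc.ne'] at hdiv
    simp only [sub_self, mul_zero, add_zero, log_inv, neg_div]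
    linarith
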